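/- arXiv:1406.2918 — 2 statements merged into one kernel-verified Lean document; each statement's English description precedes it below -/
import Mathlib

section
/- For all real constants C > 0 and α ≥ 1/3 there exist constants K > 0 and ρ₀ > 0 (depending only on C and α) such that for every real ρ ≥ ρ₀ and every real x ≥ ρ + C ρ^α, the following hold: if 1/3 ≤ α ≤ 1 then |J_ρ(x)| ≤ K ρ^{-(α+1)/4}; if 1 ≤ α ≤ 8/3 then |J_ρ(x)| ≤ K x^{-1/2} (and hence |J_ρ(x)| ≤ K' ρ^{-α/2} for a constant K' depending only on C and α); and if α ≥ 8/3 then |J_ρ(x)| ≤ K ρ^{-4/3}. -/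
/-- The Bessel function of the first kind `J_ρ(x)` for real order `ρ > 0` and `x > 0`,
defined by the series `∑_{m≥0} (-1)^m (x/2)^{2m+ρ} / (Γ(m+1) Γ(m+ρ+1))`. -/
noncomputable def besselJ (ρ x : ℝ) : ℝ :=
  ∑' m : ℕ, (-1 : ℝ) ^ m * (x / 2) ^ (2 * (m : ℝ) + ρ) /
    (Real.Gamma ((m : ℝ) + 1) * Real.Gamma ((m : ℝ) + ρ + 1))

open Filter Topology

/-- The entire factor of the Bessel function: `J_ν(x) = (x / 2) ^ ν * besselSeries ν (x ^ 2 / 4)`. -/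
noncomputable def besselSeries (ν y : ℝ) : ℝ :=
  ∑' m : ℕ, (-y) ^ m / (m.factorial * Real.Gamma (m + ν + 1))

lemma one_le_Gamma_add {ν : ℝ} (hν : 1 ≤ ν) (m : ℕ) : 1 ≤ Real.Gamma (m + ν + 1) := by
  have hm : (0 : ℝ) ≤ m := m.cast_nonneg
  have h := Real.Gamma_strictMonoOn_Ici.monotoneOn (a := 2) (b := m + ν + 1)
    (by simp) (by simp only [Set.mem_Ici]; linarith) (by linarith)
  rwa [Real.Gamma_two] at h

lemma norm_besselSeries_term_le {ν : ℝ} (hν : 1 ≤ ν) (y : ℝ) (m : ℕ) :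
    ‖(-y) ^ m / (m.factorial * Real.Gamma (m + ν + 1))‖ ≤ |y| ^ m / m.factorial := by
  have hΓ := one_le_Gamma_add hν m
  have hf : (0 : ℝ) < m.factorial := by exact_mod_cast m.factorial_pos
  rw [norm_div, norm_pow, norm_neg, Real.norm_eq_abs, Real.norm_eq_abs,
    abs_of_pos (a := (m.factorial : ℝ) * _) (by positivity)]
  gcongr
  nlinarith

lemma summable_besselSeries {ν : ℝ} (hν : 1 ≤ ν) (y : ℝ) :
    Summable fun m : ℕ => (-y) ^ m / (m.factorial * Real.Gamma (m + ν + 1)) :=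
  .of_norm_bounded (Real.summable_pow_div_factorial |y|) (norm_besselSeries_term_le hν y)

lemma abs_besselSeries_le {ν : ℝ} (hν : 1 ≤ ν) (y : ℝ) : |besselSeries ν y| ≤ Real.exp |y| := by
  have h := tsum_of_norm_bounded (Real.summable_pow_div_factorial |y|).hasSum
    (norm_besselSeries_term_le hν y)
  rw [Real.norm_eq_abs] at h
  rw [Real.exp_eq_exp_ℝ, NormedSpace.exp_eq_tsum_div]
  exact h

lemma hasDerivAt_besselSeries {ν : ℝ} (hν : 1 ≤ ν) (y : ℝ) :
    HasDerivAt (besselSeries ν) (-besselSeries (ν + 1) y) y := by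
  set R : ℝ := |y| + 1 with hR
  have hterm : ∀ m : ℕ, ∀ z : ℝ,
      HasDerivAt (fun z : ℝ => (-z) ^ m / (m.factorial * Real.Gamma (m + ν + 1)))
        (m * (-z) ^ (m - 1) * (-1) / (m.factorial * Real.Gamma (m + ν + 1))) z := fun m z =>
    (((hasDerivAt_id z).neg.pow m)).div_const _
  have hsucc : ∀ (m : ℕ) (z : ℝ),
      ((m + 1 : ℕ) : ℝ) * (-z) ^ (m + 1 - 1) * (-1) /
        ((m + 1).factorial * Real.Gamma ((m + 1 : ℕ) + ν + 1)) =
      -((-z) ^ m / (m.factorial * Real.Gamma (m + (ν + 1) + 1))) := by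
    intro m z
    have h1 : ((m + 1 : ℕ) : ℝ) + ν + 1 = m + (ν + 1) + 1 := by push_cast; ring
    have h2 : (0 : ℝ) < (m : ℝ) + 1 := by positivity
    have h3 : (0 : ℝ) < m.factorial := by exact_mod_cast m.factorial_pos
    have h4 := one_le_Gamma_add (ν := ν + 1) (by linarith) m
    rw [h1, Nat.factorial_succ, Nat.add_sub_cancel]
    push_cast
    field_simp
  have hu : Summable fun m : ℕ => (m : ℝ) * R ^ (m - 1) / m.factorial := by
    rw [← summable_nat_add_iff 1]
    refine (Real.summable_pow_div_factorial R).congr fun m => ?_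
    have h2 : (0 : ℝ) < (m : ℝ) + 1 := by positivity
    rw [Nat.factorial_succ, Nat.add_sub_cancel]
    push_cast
    field_simp
  have hmain := hasDerivAt_tsum_of_isPreconnected (t := Metric.ball (0 : ℝ) R) (y₀ := 0) (y := y)
    (g := fun (m : ℕ) (z : ℝ) => (-z) ^ m / (m.factorial * Real.Gamma (m + ν + 1)))
    (g' := fun (m : ℕ) (z : ℝ) =>
      m * (-z) ^ (m - 1) * (-1) / (m.factorial * Real.Gamma (m + ν + 1)))
    hu Metric.isOpen_ball (convex_ball _ _).isPreconnected (fun m z _ => hterm m z)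
    (fun m z hz => by
      have hΓ := one_le_Gamma_add hν m
      have hf : (0 : ℝ) < m.factorial := by exact_mod_cast m.factorial_pos
      have hz' : |z| ≤ R := by simpa using (Metric.mem_ball.1 hz).le
      rw [norm_div, norm_mul, norm_mul, norm_pow, norm_neg, norm_neg, norm_one, mul_one,
        Real.norm_eq_abs, Real.norm_eq_abs, Real.norm_eq_abs,
        abs_of_pos (a := (m.factorial : ℝ) * _) (by positivity), Nat.abs_cast]
      gcongr
      nlinarith)
    (Metric.mem_ball_self (by positivity)) (summable_besselSeries hν 0)
    (by simp [hR])
  have hs : Summable fun m : ℕ =>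
      (m : ℝ) * (-y) ^ (m - 1) * (-1) / (m.factorial * Real.Gamma (m + ν + 1)) := by
    rw [← summable_nat_add_iff 1]
    exact (summable_besselSeries (ν := ν + 1) (by linarith) y).neg.congr fun m =>
      (hsucc m y).symm
  have hval : ∑' m : ℕ, (m : ℝ) * (-y) ^ (m - 1) * (-1) /
      (m.factorial * Real.Gamma (m + ν + 1)) = -besselSeries (ν + 1) y := by
    rw [hs.tsum_eq_zero_add]
    simp only [hsucc, tsum_neg, besselSeries]
    simp
  rw [← hval]
  exact hmain

lemma besselSeries_recurrence {ν : ℝ} (hν : 1 ≤ ν) (y : ℝ) :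
    besselSeries ν y = (ν + 1) * besselSeries (ν + 1) y - y * besselSeries (ν + 2) y := by
  have h1 := summable_besselSeries (ν := ν + 1) (by linarith) y
  have h2 := summable_besselSeries (ν := ν + 2) (by linarith) y
  have hd : Summable fun m : ℕ => (m : ℝ) * ((-y) ^ m /
      (m.factorial * Real.Gamma (m + (ν + 1) + 1))) := by
    rw [← summable_nat_add_iff 1]
    refine (h2.mul_left (-y)).congr fun m => ?_
    have h2 : (0 : ℝ) < (m : ℝ) + 1 := by positivity
    have h4 := one_le_Gamma_add (ν := ν + 2) (by linarith) m
    rw [Nat.factorial_succ, show ((m + 1 : ℕ) : ℝ) + (ν + 1) + 1 = m + (ν + 2) + 1 by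
      push_cast; ring]
    push_cast
    field_simp
    ring
  have hd' : ∑' m : ℕ, (m : ℝ) * ((-y) ^ m /
      (m.factorial * Real.Gamma (m + (ν + 1) + 1))) = -y * besselSeries (ν + 2) y := by
    rw [hd.tsum_eq_zero_add, besselSeries, ← tsum_mul_left]
    simp only [Nat.cast_zero, zero_mul, zero_add]
    refine tsum_congr fun m => ?_
    have h2 : (0 : ℝ) < (m : ℝ) + 1 := by positivity
    have h4 := one_le_Gamma_add (ν := ν + 2) (by linarith) m
    rw [Nat.factorial_succ, show ((m + 1 : ℕ) : ℝ) + (ν + 1) + 1 = m + (ν + 2) + 1 by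
      push_cast; ring]
    push_cast
    field_simp
    ring
  have : besselSeries ν y = (ν + 1) * besselSeries (ν + 1) y + -y * besselSeries (ν + 2) y := by
    rw [← hd', besselSeries, besselSeries, ← tsum_mul_left, ← (h1.mul_left _).tsum_add hd]
    refine tsum_congr fun m => ?_
    have hm : (0 : ℝ) < m + ν + 1 := by positivity
    have h4 := one_le_Gamma_add hν m
    rw [show (m : ℝ) + (ν + 1) + 1 = (m + ν + 1) + 1 by ring, Real.Gamma_add_one hm.ne']
    field_simp
    ring
  linarith

lemma besselJ_eq {ν x : ℝ} (hx : 0 < x) :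
    besselJ ν x = (x / 2) ^ ν * besselSeries ν (x ^ 2 / 4) := by
  rw [besselJ, besselSeries, ← tsum_mul_left]
  refine tsum_congr fun m => ?_
  have hx2 : 0 < x / 2 := by positivity
  rw [Real.rpow_add hx2, Real.Gamma_nat_eq_factorial, neg_pow (x ^ 2 / 4),
    show (2 : ℝ) * (m : ℝ) = ((2 * m : ℕ) : ℝ) by push_cast; ring, Real.rpow_natCast, pow_mul,
    show (x / 2) ^ 2 = x ^ 2 / 4 by ring]
  ring

lemma abs_besselJ_le {ν x : ℝ} (hν : 1 ≤ ν) (hx : 0 < x) :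
    |besselJ ν x| ≤ (x / 2) ^ ν * Real.exp (x ^ 2 / 4) := by
  have h := abs_besselSeries_le hν (x ^ 2 / 4)
  rw [abs_of_nonneg (by positivity : 0 ≤ x ^ 2 / 4)] at h
  rw [besselJ_eq hx, abs_mul, abs_of_nonneg (by positivity : (0 : ℝ) ≤ (x / 2) ^ ν)]
  gcongr

/-- The three-term recurrence. -/
lemma besselJ_recurrence {ν x : ℝ} (hν : 1 ≤ ν) (hx : 0 < x) :
    x * besselJ (ν + 2) x = 2 * (ν + 1) * besselJ (ν + 1) x - x * besselJ ν x := by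
  have hx2 : 0 < x / 2 := by positivity
  rw [besselJ_eq hx, besselJ_eq hx, besselJ_eq hx, Real.rpow_add hx2, Real.rpow_add hx2,
    Real.rpow_one, Real.rpow_two, besselSeries_recurrence hν]
  ring

lemma hasDerivAt_besselJ {ν x : ℝ} (hν : 1 ≤ ν) (hx : 0 < x) :
    HasDerivAt (besselJ ν) (ν / x * besselJ ν x - besselJ (ν + 1) x) x := by
  have hx2 : 0 < x / 2 := by positivity
  have h1 : HasDerivAt (fun z : ℝ => (z / 2) ^ ν) (1 / 2 * ν * (x / 2) ^ (ν - 1)) x :=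
    ((hasDerivAt_id x).div_const 2).rpow_const (Or.inl hx2.ne')
  have h2 : HasDerivAt (fun z : ℝ => z ^ 2 / 4) (x / 2) x := by
    refine HasDerivAt.congr_deriv (((hasDerivAt_id x).pow 2).div_const 4) ?_
    simp; ring
  have h3 := (hasDerivAt_besselSeries hν (x ^ 2 / 4)).comp x h2
  have h4 := h1.mul h3
  have h5 : HasDerivAt (besselJ ν) _ x := h4.congr_of_eventuallyEq <| by
    filter_upwards [lt_mem_nhds hx] with z hz
    simp [besselJ_eq hz]
  refine HasDerivAt.congr_deriv h5 ?_
  rw [besselJ_eq hx, besselJ_eq hx, Real.rpow_add hx2, Real.rpow_sub hx2, Real.rpow_one]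
  simp only [Function.comp_apply]
  field_simp
  ring

lemma hasDerivAt_besselJ_succ {ν x : ℝ} (hν : 1 ≤ ν) (hx : 0 < x) :
    HasDerivAt (besselJ (ν + 1)) (besselJ ν x - (ν + 1) / x * besselJ (ν + 1) x) x := by
  refine HasDerivAt.congr_deriv (hasDerivAt_besselJ (ν := ν + 1) (by linarith) hx) ?_
  have h := besselJ_recurrence hν hx
  rw [show ν + 1 + 1 = ν + 2 by ring]
  field_simp
  linarith

/-- The sum `J_ν² + J_{ν+1}²`, normalised so that it stays bounded at infinity. -/
noncomputable def besselAmplitude (ν x : ℝ) : ℝ :=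
  x * (besselJ ν x ^ 2 + besselJ (ν + 1) x ^ 2)

lemma hasDerivAt_amplitude_corrected {ν x : ℝ} (hν : 1 ≤ ν) (hx : 0 < x) :
    HasDerivAt (fun z => besselAmplitude ν z - (2 * ν + 1) * (besselJ ν z * besselJ (ν + 1) z))
      ((2 * ν + 1) * (besselJ ν x * besselJ (ν + 1) x) / x) x := by
  have h0 := hasDerivAt_besselJ hν hx
  have h1 := hasDerivAt_besselJ_succ hν hx
  have h := ((hasDerivAt_id x).mul ((h0.pow 2).add (h1.pow 2))).sub
    ((h0.mul h1).const_mul (2 * ν + 1))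
  refine HasDerivAt.congr_deriv (h) ?_
  simp
  field_simp
  ring

lemma two_mul_abs_mul_besselJ_le (ν x : ℝ) :
    2 * |besselJ ν x * besselJ (ν + 1) x| ≤ besselJ ν x ^ 2 + besselJ (ν + 1) x ^ 2 := by
  rw [abs_mul, ← sq_abs (besselJ ν x), ← sq_abs (besselJ (ν + 1) x)]
  nlinarith [sq_nonneg (|besselJ ν x| - |besselJ (ν + 1) x|)]

lemma abs_mul_besselJ_le_amplitude {ν x : ℝ} (hν : 1 ≤ ν) (hx : 2 * ν + 1 ≤ x) :
    (2 * ν + 1) * |besselJ ν x * besselJ (ν + 1) x| ≤ besselAmplitude ν x / 2 := by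
  have h := two_mul_abs_mul_besselJ_le ν x
  rw [besselAmplitude]
  nlinarith [abs_nonneg (besselJ ν x * besselJ (ν + 1) x)]

lemma besselAmplitude_le_of_le {ν x₀ x : ℝ} (hν : 1 ≤ ν) (hx₀ : 2 * ν + 1 ≤ x₀) (hx : x₀ ≤ x) :
    besselAmplitude ν x ≤ 3 * Real.exp 1 * besselAmplitude ν x₀ := by
  set c := 2 * ν + 1 with hc
  set B : ℝ → ℝ := fun z => besselAmplitude ν z - c * (besselJ ν z * besselJ (ν + 1) z) with hB
  have hpos : ∀ z ∈ Set.Ici x₀, 0 < z := fun z hz => by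
    have := Set.mem_Ici.1 hz
    linarith
  have hderiv : ∀ z, 0 < z → HasDerivAt (fun z => B z * Real.exp (c / z))
      (Real.exp (c / z) * (c * (besselJ ν z * besselJ (ν + 1) z) / z - B z * (c / z ^ 2))) z := by
    intro z hz
    have h1 := hasDerivAt_amplitude_corrected hν hz
    have h2 : HasDerivAt (fun z : ℝ => c / z) (-(c / z ^ 2)) z := by
      refine HasDerivAt.congr_deriv ((hasDerivAt_const z c).div (hasDerivAt_id z) hz.ne') ?_
      simp [neg_div]
    refine HasDerivAt.congr_deriv (h1.mul h2.exp) ?_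
    ring
  have hanti : AntitoneOn (fun z => B z * Real.exp (c / z)) (Set.Ici x₀) := by
    refine antitoneOn_of_hasDerivWithinAt_nonpos (convex_Ici x₀)
      (fun z hz => (hderiv z (hpos z hz)).continuousAt.continuousWithinAt)
      (fun z hz => (hderiv z (hpos z (interior_subset hz))).hasDerivWithinAt) fun z hz => ?_
    have hz := interior_subset hz
    have hz0 := hpos z hz
    have h := abs_mul_besselJ_le_amplitude hν (hx₀.trans hz)
    have h4 := le_abs_self (besselJ ν z * besselJ (ν + 1) z)
    refine mul_nonpos_of_nonneg_of_nonpos (Real.exp_nonneg _) ?_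
    have h5 : z * (besselJ ν z * besselJ (ν + 1) z) ≤ B z := by
      have : 2 * |besselJ ν z * besselJ (ν + 1) z| * z ≤ besselAmplitude ν z := by
        have h := two_mul_abs_mul_besselJ_le ν z
        rw [besselAmplitude]
        nlinarith
      simp only [hB]
      nlinarith
    have h6 : c * (besselJ ν z * besselJ (ν + 1) z) / z - B z * (c / z ^ 2) =
        c / z ^ 2 * (z * (besselJ ν z * besselJ (ν + 1) z) - B z) := by
      field_simp
    rw [h6]
    exact mul_nonpos_of_nonneg_of_nonpos (by positivity) (by linarith)
  have hle := hanti Set.self_mem_Ici (Set.mem_Ici.2 hx) hx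
  have hx0 := hpos x hx
  have hx00 := hpos x₀ Set.self_mem_Ici
  have hlo := abs_mul_besselJ_le_amplitude hν (hx₀.trans hx)
  have hhi := abs_mul_besselJ_le_amplitude hν hx₀
  have h1 : besselAmplitude ν x / 2 ≤ B x := by
    have := le_abs_self (besselJ ν x * besselJ (ν + 1) x)
    simp only [hB]
    nlinarith
  have h2 : B x₀ ≤ 3 / 2 * besselAmplitude ν x₀ := by
    have := neg_abs_le (besselJ ν x₀ * besselJ (ν + 1) x₀)
    simp only [hB]
    nlinarith
  have hA : 0 ≤ besselAmplitude ν x := by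
    rw [besselAmplitude]; positivity
  have hA0 : 0 ≤ besselAmplitude ν x₀ := by
    rw [besselAmplitude]; positivity
  have e1 : 1 ≤ Real.exp (c / x) := Real.one_le_exp (by positivity)
  have e2 : Real.exp (c / x₀) ≤ Real.exp 1 := by
    rw [Real.exp_le_exp, div_le_one hx00]
    exact hx₀
  have h3 : B x ≤ B x * Real.exp (c / x) := le_mul_of_one_le_right (by linarith) e1
  have h4 : B x₀ * Real.exp (c / x₀) ≤ 3 / 2 * besselAmplitude ν x₀ * Real.exp 1 := by
    gcongr
  simp only at hle
  linarith

/-- The amplitudes of all orders `ν ≥ 1` are eventually below a bound independent of `ν`. -/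
lemma exists_eventually_besselAmplitude_le :
    ∃ M : ℝ, 0 < M ∧ ∀ ν : ℝ, 1 ≤ ν → ∀ᶠ x in atTop, besselAmplitude ν x ≤ M := by
  set M : ℝ := 3 * Real.exp 1 * (10 * (2 * (125 * Real.exp 25) ^ 2)) with hM
  have hM0 : 0 < M := by positivity
  have hbase : ∀ ν : ℝ, 1 ≤ ν → ν ≤ 2 → ∀ x : ℝ, 10 ≤ x → besselAmplitude ν x ≤ M := by
    intro ν h1 h2 x hx
    refine (besselAmplitude_le_of_le h1 (by linarith) hx).trans ?_
    have hJ : ∀ μ : ℝ, 1 ≤ μ → μ ≤ 3 → besselJ μ 10 ^ 2 ≤ (125 * Real.exp 25) ^ 2 := by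
      intro μ h1 h3
      rw [← sq_abs]
      have h := abs_besselJ_le h1 (x := 10) (by norm_num)
      have h5 : ((10 : ℝ) / 2) ^ μ ≤ 125 := by
        calc ((10 : ℝ) / 2) ^ μ ≤ (10 / 2) ^ (3 : ℝ) :=
              Real.rpow_le_rpow_of_exponent_le (by norm_num) h3
          _ = 125 := by norm_num
      rw [show (10 : ℝ) ^ 2 / 4 = 25 by norm_num] at h
      gcongr
      exact h.trans (by gcongr)
    rw [hM, besselAmplitude]
    gcongr
    linarith [hJ ν h1 (by linarith), hJ (ν + 1) (by linarith) (by linarith)]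
  have key : ∀ n : ℕ, ∀ ν : ℝ, 1 ≤ ν → ν ≤ n + 2 → ∀ B : ℝ, M < B →
      ∀ᶠ x in atTop, besselAmplitude ν x ≤ B := by
    intro n
    induction n with
    | zero =>
      intro ν h1 h2 B hB
      filter_upwards [eventually_ge_atTop 10] with x hx
      exact (hbase ν h1 (by simpa using h2) x hx).trans hB.le
    | succ n ih =>
      intro ν h1 h2 B hB
      rcases le_total ν 2 with h | h
      · filter_upwards [eventually_ge_atTop 10] with x hx
        exact (hbase ν h1 h x hx).trans hB.le
      · push_cast at h2
        obtain ⟨μ, rfl⟩ : ∃ μ, ν = μ + 1 := ⟨ν - 1, by ring⟩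
        have hμ : 1 ≤ μ := by linarith
        have hlim : Tendsto (fun x : ℝ => (1 + 2 * (μ + 1) / x + (2 * (μ + 1) / x) ^ 2) *
            ((M + B) / 2)) atTop (𝓝 ((1 + 0 + 0 ^ 2) * ((M + B) / 2))) := by
          have h := tendsto_const_nhds (x := 2 * (μ + 1)).div_atTop tendsto_id (l := atTop)
          exact ((h.const_add 1).add (h.pow 2)).mul_const _
        filter_upwards [ih μ hμ (by linarith) ((M + B) / 2) (by linarith),
          hlim.eventually_le_const (by linarith : _ < B), eventually_gt_atTop 0]
          with x hA hB hx
        refine le_trans ?_ hB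
        refine le_trans ?_ (mul_le_mul_of_nonneg_left hA (by positivity))
        have hrec := besselJ_recurrence hμ hx
        set c := 2 * (μ + 1) / x with hc
        have hc0 : 0 ≤ c := by positivity
        have hrec' : besselJ (μ + 2) x = c * besselJ (μ + 1) x - besselJ μ x := by
          rw [hc]
          field_simp
          linarith
        rw [besselAmplitude, besselAmplitude, show μ + 1 + 1 = μ + 2 by ring, hrec',
          mul_left_comm]
        gcongr
        nlinarith [mul_nonneg hc0 (sq_nonneg (besselJ (μ + 1) x + besselJ μ x)),
          sq_nonneg (c * besselJ μ x)]
  refine ⟨M + 1, by linarith, fun ν hν => ?_⟩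
  obtain ⟨n, hn⟩ := exists_nat_ge ν
  exact key n ν hν (by linarith) (M + 1) (by linarith)

/-- The fourth root of `x ^ 2 - ρ ^ 2`. -/
noncomputable def quarticRoot (ρ x : ℝ) : ℝ := √√(x ^ 2 - ρ ^ 2)

lemma quarticRoot_pos {ρ x : ℝ} (hρ : 0 ≤ ρ) (hx : ρ < x) : 0 < quarticRoot ρ x :=
  Real.sqrt_pos.2 (Real.sqrt_pos.2 (by nlinarith))

lemma quarticRoot_pow_four {ρ x : ℝ} (hρ : 0 ≤ ρ) (hx : ρ ≤ x) :
    quarticRoot ρ x ^ 4 = x ^ 2 - ρ ^ 2 := by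
  rw [quarticRoot, show 4 = 2 * 2 from rfl, pow_mul, Real.sq_sqrt (Real.sqrt_nonneg _),
    Real.sq_sqrt (by nlinarith)]

lemma hasDerivAt_quarticRoot {ρ x : ℝ} (hρ : 0 ≤ ρ) (hx : ρ < x) :
    HasDerivAt (quarticRoot ρ) (x / (2 * quarticRoot ρ x ^ 3)) x := by
  have hQ : 0 < x ^ 2 - ρ ^ 2 := by nlinarith
  have hs : 0 < √(x ^ 2 - ρ ^ 2) := Real.sqrt_pos.2 hQ
  have h1 : HasDerivAt (fun z : ℝ => z ^ 2 - ρ ^ 2) (2 * x) x := by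
    simpa using ((hasDerivAt_id x).pow 2).sub_const (ρ ^ 2)
  have h2 := (h1.sqrt hQ.ne').sqrt hs.ne'
  refine HasDerivAt.congr_deriv (h2) ?_
  have hr := quarticRoot_pos hρ hx
  have hr2 : quarticRoot ρ x ^ 2 = √(x ^ 2 - ρ ^ 2) := Real.sq_sqrt hs.le
  change 2 * x / (2 * √(x ^ 2 - ρ ^ 2)) / (2 * quarticRoot ρ x) = _
  rw [← hr2]
  field_simp

/-- The Liouville–Green energy of `J_ρ`: with `r = (x ^ 2 - ρ ^ 2) ^ (1 / 4)`, the sum of the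
squares of `r * J_ρ` and of its derivative with respect to the Liouville variable. -/
noncomputable def besselEnergy (ρ x : ℝ) : ℝ :=
  (quarticRoot ρ x * besselJ ρ x) ^ 2 +
    ((ρ * besselJ ρ x - x * besselJ (ρ + 1) x) / quarticRoot ρ x +
      x ^ 2 * besselJ ρ x / (2 * quarticRoot ρ x ^ 5)) ^ 2

/-- The total variation over `(x, ∞)` of the error-control function of the Liouville–Green
approximation. -/
noncomputable def errorControl (ρ x : ℝ) : ℝ :=
  1 / (4 * quarticRoot ρ x ^ 2) + 5 * ρ ^ 2 / (12 * quarticRoot ρ x ^ 6)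

lemma hasDerivAt_errorControl {ρ x : ℝ} (hρ : 0 ≤ ρ) (hx : ρ < x) :
    HasDerivAt (errorControl ρ)
      (-(x * (5 * x ^ 2 - 4 * quarticRoot ρ x ^ 4) / (4 * quarticRoot ρ x ^ 10))) x := by
  have hr := quarticRoot_pos hρ hx
  have hd := hasDerivAt_quarticRoot hρ hx
  have h1 := (hasDerivAt_const x (1 : ℝ)).div ((hd.pow 2).const_mul 4)
    (by simp only [Pi.pow_apply]; positivity)
  have h2 := (hasDerivAt_const x (5 * ρ ^ 2)).div ((hd.pow 6).const_mul 12)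
    (by simp only [Pi.pow_apply]; positivity)
  have h4 := quarticRoot_pow_four hρ hx.le
  refine HasDerivAt.congr_deriv (h1.add h2) ?_
  simp only [Pi.pow_apply]
  have h5 : 5 * x ^ 2 = 5 * (quarticRoot ρ x ^ 4 + ρ ^ 2) := by linarith
  rw [h5]
  push_cast
  field_simp
  ring

lemma hasDerivAt_besselEnergy {ρ x : ℝ} (hρ : 1 ≤ ρ) (hx : ρ < x) :
    HasDerivAt (besselEnergy ρ)
      (-(2 * (x * (5 * x ^ 2 - 4 * quarticRoot ρ x ^ 4) / (4 * quarticRoot ρ x ^ 10)) *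
        (quarticRoot ρ x * besselJ ρ x) *
        ((ρ * besselJ ρ x - x * besselJ (ρ + 1) x) / quarticRoot ρ x +
          x ^ 2 * besselJ ρ x / (2 * quarticRoot ρ x ^ 5)))) x := by
  have hρ0 : 0 ≤ ρ := by linarith
  have hx0 : 0 < x := by linarith
  have hr := quarticRoot_pos hρ0 hx
  have hd := hasDerivAt_quarticRoot hρ0 hx
  have h4 := quarticRoot_pow_four hρ0 hx.le
  have hJ := hasDerivAt_besselJ hρ hx0
  have hJ1 := hasDerivAt_besselJ_succ hρ hx0
  have hv : HasDerivAt (fun z => quarticRoot ρ z * besselJ ρ z)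
      (quarticRoot ρ x ^ 2 / x * ((ρ * besselJ ρ x - x * besselJ (ρ + 1) x) / quarticRoot ρ x +
        x ^ 2 * besselJ ρ x / (2 * quarticRoot ρ x ^ 5))) x := by
    refine HasDerivAt.congr_deriv (hd.mul hJ) ?_
    field_simp
    ring
  have hD : HasDerivAt (fun z => ρ * besselJ ρ z - z * besselJ (ρ + 1) z)
      (-(quarticRoot ρ x ^ 4 / x * besselJ ρ x)) x := by
    refine HasDerivAt.congr_deriv ((hJ.const_mul ρ).sub ((hasDerivAt_id x).mul hJ1)) ?_
    rw [h4]
    simp only [id]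
    field_simp
    ring
  have hw1 := hD.div hd hr.ne'
  have hw2 := (((hasDerivAt_id x).pow 2).mul hJ).div ((hd.pow 5).const_mul 2)
    (by simp only [Pi.pow_apply]; positivity)
  have hw : HasDerivAt (fun z => (ρ * besselJ ρ z - z * besselJ (ρ + 1) z) / quarticRoot ρ z +
      z ^ 2 * besselJ ρ z / (2 * quarticRoot ρ z ^ 5))
      (-(quarticRoot ρ x ^ 2 / x + x * (5 * x ^ 2 - 4 * quarticRoot ρ x ^ 4) /
        (4 * quarticRoot ρ x ^ 10)) * (quarticRoot ρ x * besselJ ρ x)) x := by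
    refine HasDerivAt.congr_deriv (hw1.add hw2) ?_
    simp only [Pi.pow_apply, Pi.mul_apply, id]
    push_cast
    field_simp
    ring
  refine HasDerivAt.congr_deriv ((hv.pow 2).add (hw.pow 2)) ?_
  push_cast
  ring

lemma besselEnergy_le_of_le {ρ x y : ℝ} (hρ : 1 ≤ ρ) (hx : ρ < x) (hxy : x ≤ y) :
    besselEnergy ρ x ≤ Real.exp (errorControl ρ x) * besselEnergy ρ y := by
  have hρ0 : 0 ≤ ρ := by linarith
  have hderiv : ∀ z, ρ < z → HasDerivAt
      (fun z => besselEnergy ρ z * Real.exp (-errorControl ρ z)) _ z := fun z hz =>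
    (hasDerivAt_besselEnergy hρ hz).mul (hasDerivAt_errorControl hρ0 hz).neg.exp
  have hmono : MonotoneOn (fun z => besselEnergy ρ z * Real.exp (-errorControl ρ z))
      (Set.Ici x) := by
    refine monotoneOn_of_hasDerivWithinAt_nonneg (convex_Ici x)
      (fun z hz => (hderiv z (hx.trans_le hz)).continuousAt.continuousWithinAt)
      (fun z hz => (hderiv z (hx.trans_le (interior_subset hz))).hasDerivWithinAt) fun z hz => ?_
    have hz : ρ < z := hx.trans_le (interior_subset hz)
    have hr := quarticRoot_pos hρ0 hz
    have h4 := quarticRoot_pow_four hρ0 hz.le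
    have hg : 0 ≤ z * (5 * z ^ 2 - 4 * quarticRoot ρ z ^ 4) / (4 * quarticRoot ρ z ^ 10) := by
      have : 0 ≤ 5 * z ^ 2 - 4 * quarticRoot ρ z ^ 4 := by rw [h4]; nlinarith
      have : 0 ≤ z := by linarith
      positivity
    rw [besselEnergy, neg_neg]
    change 0 ≤ _ + _ * (Real.exp (-errorControl ρ z) * _)
    set g := z * (5 * z ^ 2 - 4 * quarticRoot ρ z ^ 4) / (4 * quarticRoot ρ z ^ 10)
    set v := quarticRoot ρ z * besselJ ρ z
    set w := (ρ * besselJ ρ z - z * besselJ (ρ + 1) z) / quarticRoot ρ z +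
      z ^ 2 * besselJ ρ z / (2 * quarticRoot ρ z ^ 5)
    have he := Real.exp_nonneg (-errorControl ρ z)
    nlinarith [mul_nonneg (mul_nonneg he hg) (sq_nonneg (v - w))]
  have h := hmono Set.self_mem_Ici (Set.mem_Ici.2 hxy) hxy
  simp only at h
  have hy : 0 ≤ errorControl ρ y := by
    have := quarticRoot_pos hρ0 (hx.trans_le hxy)
    rw [errorControl]
    positivity
  have hE : 0 ≤ besselEnergy ρ y := by rw [besselEnergy]; positivity
  have h1 : besselEnergy ρ y * Real.exp (-errorControl ρ y) ≤ besselEnergy ρ y :=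
    mul_le_of_le_one_right hE (Real.exp_le_one_iff.2 (by linarith))
  rw [Real.exp_neg (errorControl ρ x), ← div_eq_mul_inv] at h
  have h2 := (div_le_iff₀ (Real.exp_pos _)).1 (h.trans h1)
  linarith

lemma besselEnergy_le_amplitude {ρ x : ℝ} (hρ : 1 ≤ ρ) (hx : 2 * ρ + 2 ≤ x) :
    besselEnergy ρ x ≤ 9 * besselAmplitude ρ x := by
  have hρ0 : 0 ≤ ρ := by linarith
  have hr := quarticRoot_pos hρ0 (show ρ < x by linarith)
  have h4 := quarticRoot_pow_four hρ0 (show ρ ≤ x by linarith)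
  rw [besselEnergy, besselAmplitude]
  set r := quarticRoot ρ x
  set a := besselJ ρ x
  set b := besselJ (ρ + 1) x
  have hx0 : 0 < x := by linarith
  have hup : r ^ 2 ≤ x := by
    refine le_of_sq_le_sq ?_ hx0.le
    nlinarith
  have hlo : x ≤ 2 * r ^ 2 := by
    refine le_of_sq_le_sq ?_ (by positivity)
    nlinarith
  have h1 : (r * a) ^ 2 ≤ x * a ^ 2 := by
    rw [mul_pow]
    gcongr
  have ht : x ^ 2 / (2 * r ^ 4) ≤ 2 := by
    rw [div_le_iff₀ (by positivity)]
    nlinarith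
  have ht0 : 0 ≤ x ^ 2 / (2 * r ^ 4) := by positivity
  have h2 : (ρ * a - x * b) / r + x ^ 2 * a / (2 * r ^ 5) =
      ((ρ + x ^ 2 / (2 * r ^ 4)) * a - x * b) / r := by
    field_simp
    ring
  have h3 : ((ρ + x ^ 2 / (2 * r ^ 4)) * a - x * b) ^ 2 ≤ 2 * x ^ 2 * (a ^ 2 + b ^ 2) := by
    have h5 : (ρ + x ^ 2 / (2 * r ^ 4)) ^ 2 ≤ x ^ 2 := by
      gcongr
      linarith
    have h6 := mul_le_mul_of_nonneg_right h5 (sq_nonneg a)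
    nlinarith [sq_nonneg ((ρ + x ^ 2 / (2 * r ^ 4)) * a + x * b)]
  rw [h2, div_pow]
  have h5 : ((ρ + x ^ 2 / (2 * r ^ 4)) * a - x * b) ^ 2 / r ^ 2 ≤ 4 * x * (a ^ 2 + b ^ 2) := by
    rw [div_le_iff₀ (by positivity)]
    refine h3.trans ?_
    have : 0 ≤ (a ^ 2 + b ^ 2) * x := by positivity
    nlinarith
  have : 0 ≤ x * b ^ 2 := by positivity
  have : 0 ≤ x * a ^ 2 := by positivity
  nlinarith

/-- A uniform Liouville–Green bound in the oscillatory region. -/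
lemma exists_besselJ_oscillatory_bound :
    ∃ L : ℝ, 0 < L ∧ ∀ ρ x : ℝ, 1 ≤ ρ → ρ < x →
      (x ^ 2 - ρ ^ 2) * besselJ ρ x ^ 4 ≤ (L * Real.exp (errorControl ρ x)) ^ 2 := by
  obtain ⟨M, hM, h⟩ := exists_eventually_besselAmplitude_le
  refine ⟨9 * M, by positivity, fun ρ x hρ hx => ?_⟩
  obtain ⟨y, hA, hy1, hy2⟩ := ((h ρ hρ).and
    ((eventually_ge_atTop (2 * ρ + 2)).and (eventually_ge_atTop x))).exists
  have h1 := besselEnergy_le_of_le hρ hx hy2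
  have h2 := besselEnergy_le_amplitude hρ hy1
  have h3 : (quarticRoot ρ x * besselJ ρ x) ^ 2 ≤ besselEnergy ρ x :=
    le_add_of_nonneg_right (sq_nonneg _)
  have h4 := quarticRoot_pow_four (by linarith) hx.le
  have h5 : (quarticRoot ρ x * besselJ ρ x) ^ 2 ≤ 9 * M * Real.exp (errorControl ρ x) := by
    have := mul_le_mul_of_nonneg_left (h2.trans (by gcongr : _ ≤ 9 * M))
      (Real.exp_nonneg (errorControl ρ x))
    linarith
  calc (x ^ 2 - ρ ^ 2) * besselJ ρ x ^ 4 = ((quarticRoot ρ x * besselJ ρ x) ^ 2) ^ 2 := by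
        rw [← h4]; ring
    _ ≤ _ := by gcongr

lemma errorControl_le {C ρ x : ℝ} (hC : 0 < C) (hρ : 1 ≤ ρ) (hx : ρ + C * ρ ^ ((1 : ℝ) / 3) ≤ x) :
    errorControl ρ x ≤ 1 / (4 * √C) + 5 / (12 * √C ^ 3) := by
  have hρ0 : 0 < ρ := by linarith
  have ht : 1 ≤ ρ ^ ((1 : ℝ) / 3) := Real.one_le_rpow hρ (by norm_num)
  have ht3 : (ρ ^ ((1 : ℝ) / 3)) ^ 3 = ρ := by
    rw [← Real.rpow_natCast, ← Real.rpow_mul hρ0.le]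
    norm_num
  set t := ρ ^ ((1 : ℝ) / 3)
  have hCt : 0 < C * t := by positivity
  have hr := quarticRoot_pos hρ0.le (show ρ < x by linarith)
  have h4 := quarticRoot_pow_four hρ0.le (show ρ ≤ x by linarith)
  have hC2 : √C ^ 2 = C := Real.sq_sqrt hC.le
  have hs : 0 < √C := Real.sqrt_pos.2 hC
  have h2 : √C * t ^ 2 ≤ quarticRoot ρ x ^ 2 := by
    refine le_of_sq_le_sq ?_ (by positivity)
    calc (√C * t ^ 2) ^ 2 = C * t * t ^ 3 := by rw [mul_pow, hC2]; ring
      _ ≤ (x - ρ) * (x + ρ) := by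
        rw [ht3]
        gcongr <;> linarith
      _ = (quarticRoot ρ x ^ 2) ^ 2 := by rw [← pow_mul, h4]; ring
  have h2' : √C ≤ quarticRoot ρ x ^ 2 := by nlinarith
  have h6 : √C ^ 3 * ρ ^ 2 ≤ quarticRoot ρ x ^ 6 := by
    calc √C ^ 3 * ρ ^ 2 = (√C * t ^ 2) ^ 3 := by rw [← ht3]; ring
      _ ≤ (quarticRoot ρ x ^ 2) ^ 3 := by gcongr
      _ = _ := by ring
  rw [errorControl]
  refine add_le_add (by gcongr) ?_
  rw [div_le_div_iff₀ (by positivity) (by positivity)]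
  linarith

lemma le_mul_rpow_of_pow_four_le {a K D y e : ℝ} (hK : 1 ≤ K) (hD : D ≤ K) (hy : 0 < y)
    (h : a ^ 4 ≤ D * y ^ (4 * e)) : |a| ≤ K * y ^ e := by
  have hy' : 0 < y ^ e := Real.rpow_pos_of_pos hy e
  refine le_of_pow_le_pow_left₀ (n := 4) (by norm_num) (by positivity) ?_
  have h4 : (y ^ e) ^ 4 = y ^ (4 * e) := by
    rw [mul_comm, Real.rpow_mul hy.le, ← Real.rpow_natCast]
    norm_num
  rw [Even.pow_abs (by decide), mul_pow, h4]
  refine h.trans ?_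
  gcongr
  exact hD.trans (le_self_pow₀ hK (by norm_num))

/-- For all real `C > 0` and `α ≥ 1/3` there exist `K, K' > 0` and
`ρ₀ > 0` (depending only on `C` and `α`) such that for all real `ρ ≥ ρ₀` and
`x ≥ ρ + C ρ^α`: if `1/3 ≤ α ≤ 1` then `|J_ρ(x)| ≤ K ρ^{-(α+1)/4}`;
if `1 ≤ α ≤ 8/3` then `|J_ρ(x)| ≤ K x^{-1/2}` and `|J_ρ(x)| ≤ K' ρ^{-α/2}`;
and if `α ≥ 8/3` then `|J_ρ(x)| ≤ K ρ^{-4/3}`. -/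
theorem besselJ_above_transition_bound (C α : ℝ) (hC : 0 < C) (hα : (1 : ℝ) / 3 ≤ α) :
    ∃ K K' ρ₀ : ℝ, 0 < K ∧ 0 < K' ∧ 0 < ρ₀ ∧
      ∀ ρ x : ℝ, ρ₀ ≤ ρ → ρ + C * ρ ^ α ≤ x →
        (((1 : ℝ) / 3 ≤ α ∧ α ≤ 1 → |besselJ ρ x| ≤ K * ρ ^ (-(α + 1) / 4)) ∧
         ((1 : ℝ) ≤ α ∧ α ≤ 8 / 3 →
            |besselJ ρ x| ≤ K * x ^ (-(1 : ℝ) / 2) ∧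
            |besselJ ρ x| ≤ K' * ρ ^ (-α / 2)) ∧
         ((8 : ℝ) / 3 ≤ α → |besselJ ρ x| ≤ K * ρ ^ (-(4 : ℝ) / 3))) := by
  obtain ⟨L, hL, hbound⟩ := exists_besselJ_oscillatory_bound
  set N : ℝ := (L * Real.exp (1 / (4 * √C) + 5 / (12 * √C ^ 3))) ^ 2 with hN
  have hN0 : 0 < N := by positivity
  set D₁ : ℝ := N / C with hD₁
  set D₂ : ℝ := N * (1 + C) / C with hD₂
  set D₃ : ℝ := D₂ / C ^ 2 with hD₃
  have hD₁0 : 0 < D₁ := by positivity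
  have hD₂0 : 0 < D₂ := by positivity
  have hD₃0 : 0 < D₃ := by positivity
  set K : ℝ := 1 + D₁ + D₂ + D₃ with hK
  have hK1 : 1 ≤ K := by linarith
  refine ⟨K, K, 1, by linarith, by linarith, one_pos, fun ρ x hρ hx => ?_⟩
  have hρ0 : 0 < ρ := by linarith
  have hpow : 0 < ρ ^ α := Real.rpow_pos_of_pos hρ0 α
  have hCpow : 0 < C * ρ ^ α := by positivity
  have hρx : ρ < x := by linarith
  have hx0 : 0 < x := by linarith
  have hmain : (x ^ 2 - ρ ^ 2) * besselJ ρ x ^ 4 ≤ N := by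
    refine (hbound ρ x hρ hρx).trans ?_
    rw [hN]
    gcongr
    refine errorControl_le hC hρ (le_trans ?_ hx)
    gcongr
  have hlarge : 1 ≤ α → besselJ ρ x ^ 4 ≤ D₂ * (x ^ 2)⁻¹ := by
    intro h1
    have hρα : ρ ≤ ρ ^ α := Real.self_le_rpow_of_one_le hρ h1
    have hx1 : (1 + C) * ρ ≤ x := by nlinarith
    have hq : C / (1 + C) * x ^ 2 ≤ x ^ 2 - ρ ^ 2 := by
      have h2 : ρ * ((1 + C) * ρ) ≤ x * x := by gcongr
      have : x ^ 2 - ρ ^ 2 - C / (1 + C) * x ^ 2 = (x * x - ρ * ((1 + C) * ρ)) / (1 + C) := by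
        field_simp
        ring
      have : 0 ≤ (x * x - ρ * ((1 + C) * ρ)) / (1 + C) := div_nonneg (by linarith) (by linarith)
      linarith
    have h3 := (mul_le_mul_of_nonneg_right hq (by positivity : 0 ≤ besselJ ρ x ^ 4)).trans hmain
    rw [hD₂]
    field_simp at h3 ⊢
    linarith
  have hsmall : 1 ≤ α → besselJ ρ x ^ 4 ≤ D₃ * ρ ^ (-2 * α) := by
    intro h1
    refine (hlarge h1).trans ?_
    rw [show -2 * α = -(α * 2) by ring, Real.rpow_neg hρ0.le, Real.rpow_mul hρ0.le,
      Real.rpow_two]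
    calc D₂ * (x ^ 2)⁻¹ ≤ D₂ * ((C * ρ ^ α) ^ 2)⁻¹ := by
          gcongr
          linarith
      _ = D₃ * ((ρ ^ α) ^ 2)⁻¹ := by
          rw [hD₃]
          field_simp
  refine ⟨fun _ => ?_, fun ⟨h1, _⟩ => ⟨?_, ?_⟩, fun h1 => ?_⟩
  · refine le_mul_rpow_of_pow_four_le hK1 (D := D₁) (by linarith) hρ0 ?_
    rw [show 4 * (-(α + 1) / 4) = -(α + 1) by ring, Real.rpow_neg hρ0.le,
      Real.rpow_add_one hρ0.ne']
    have hq : C * ρ ^ α * ρ ≤ x ^ 2 - ρ ^ 2 := by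
      rw [sq_sub_sq, mul_comm (x + ρ)]
      gcongr <;> linarith
    have h3 := (mul_le_mul_of_nonneg_right hq (by positivity : 0 ≤ besselJ ρ x ^ 4)).trans hmain
    rw [hD₁]
    field_simp
    linarith
  · refine le_mul_rpow_of_pow_four_le hK1 (D := D₂) (by linarith) hx0 ?_
    rw [show 4 * (-(1 : ℝ) / 2) = -2 by norm_num, Real.rpow_neg hx0.le, Real.rpow_two]
    exact hlarge h1
  · refine le_mul_rpow_of_pow_four_le hK1 (D := D₃) (by linarith) hρ0 ?_
    rw [show 4 * (-α / 2) = -2 * α by ring]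
    exact hsmall h1
  · refine le_mul_rpow_of_pow_four_le hK1 (D := D₃) (by linarith) hρ0 ?_
    refine (hsmall (by linarith)).trans ?_
    exact mul_le_mul_of_nonneg_left
      (Real.rpow_le_rpow_of_exponent_le hρ (by linarith)) hD₃0.le
end

section
/- There exist constants K > 0 and k₀ > 0 such that for every real k ≥ k₀ and every real M > 0, one has ∑_{c ∈ ℕ, c ≥ 4π √(2/(k-1)) · M} |J_{k-1}(4πM/c)| ≤ K · k^{-k/2} · (1 + M · k^{-3/2}), where the sum is over positive integers c with c ≥ 4π √(2/(k-1)) · M (equivalently, those c for which 4πM/c ≤ √((k-1)/2)). -/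
open Real

/-- A Stirling-type lower bound for the Gamma function. -/
lemma rpow_mul_exp_neg_le_Gamma_add_one {ρ : ℝ} (hρ : 0 < ρ) :
    ρ ^ ρ * exp (-ρ) ≤ Gamma (ρ + 1) := by
  rw [Gamma_eq_integral (by linarith)]
  have hint := GammaIntegral_convergent (s := ρ + 1) (by linarith)
  have hsub : Set.Ioi ρ ⊆ Set.Ioi (0 : ℝ) := Set.Ioi_subset_Ioi hρ.le
  calc ρ ^ ρ * exp (-ρ) = ∫ t in Set.Ioi ρ, ρ ^ ρ * exp (-t) := by
        rw [MeasureTheory.integral_const_mul, integral_exp_neg_Ioi]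
    _ ≤ ∫ t in Set.Ioi ρ, exp (-t) * t ^ (ρ + 1 - 1) := by
        refine MeasureTheory.setIntegral_mono_on ((integrableOn_exp_neg_Ioi ρ).const_mul _)
          (hint.mono_set hsub) measurableSet_Ioi fun t ht => ?_
        rw [add_sub_cancel_right, mul_comm]
        gcongr
        exact (Set.mem_Ioi.1 ht).le
    _ ≤ ∫ t in Set.Ioi 0, exp (-t) * t ^ (ρ + 1 - 1) := by
        refine MeasureTheory.setIntegral_mono_set hint ?_ hsub.eventuallyLE
        filter_upwards [MeasureTheory.ae_restrict_mem measurableSet_Ioi] with t ht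
        exact mul_nonneg (exp_pos _).le (rpow_nonneg (Set.mem_Ioi.1 ht).le _)

lemma pow_mul_Gamma_le_Gamma_add {ρ : ℝ} (hρ : 0 < ρ) (m : ℕ) :
    ρ ^ m * Gamma (ρ + 1) ≤ Gamma (m + ρ + 1) := by
  induction m with
  | zero => simp
  | succ m ih =>
    have hpos : 0 < (m : ℝ) + ρ + 1 := by positivity
    have hG : Gamma ((m + 1 : ℕ) + ρ + 1) = (m + ρ + 1) * Gamma (m + ρ + 1) := by
      rw [← Gamma_add_one hpos.ne']
      push_cast
      ring_nf
    rw [hG, pow_succ, mul_right_comm, mul_comm _ ρ]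
    have := Gamma_pos_of_pos hpos
    gcongr
    have : (0 : ℝ) ≤ m := m.cast_nonneg
    linarith

/-- For arguments up to `√(ρ / 2)`, the Bessel function is controlled by its leading term. -/
lemma abs_besselJ_le_s18 {ρ x : ℝ} (hρ : 0 < ρ) (hx : 0 < x) (hxρ : x ^ 2 ≤ ρ / 2) :
    |besselJ ρ x| ≤ (x / 2) ^ ρ / Gamma (ρ + 1) * 2 := by
  rw [← norm_eq_abs, besselJ]
  refine tsum_of_norm_bounded (hasSum_geometric_two.mul_left _) fun m => ?_
  have hG : 0 < Gamma (ρ + 1) := Gamma_pos_of_pos (by linarith)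
  have hGm : 0 < Gamma (m + ρ + 1) := Gamma_pos_of_pos (by positivity)
  have hpow : (x / 2) ^ (2 * (m : ℝ) + ρ) = (x / 2) ^ ρ * ((x / 2) ^ 2) ^ m := by
    rw [rpow_add (by positivity), ← pow_mul, ← rpow_natCast]
    push_cast
    ring
  rw [norm_div, norm_mul, norm_pow, norm_neg, norm_one, one_pow, one_mul, Gamma_nat_eq_factorial,
    hpow, norm_of_nonneg (by positivity), norm_of_nonneg (by positivity), div_mul_eq_mul_div]
  have hfac : (1 : ℝ) ≤ m.factorial := by exact_mod_cast m.factorial_pos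
  have hmain : ((x / 2) ^ 2) ^ m * Gamma (ρ + 1) ≤ (1 / 2) ^ m * Gamma (m + ρ + 1) :=
    calc ((x / 2) ^ 2) ^ m * Gamma (ρ + 1) ≤ (1 / 2 * ρ) ^ m * Gamma (ρ + 1) := by
          gcongr
          nlinarith
      _ = (1 / 2) ^ m * (ρ ^ m * Gamma (ρ + 1)) := by rw [mul_pow]; ring
      _ ≤ _ := by gcongr; exact pow_mul_Gamma_le_Gamma_add hρ m
  rw [div_le_div_iff₀ (by positivity) hG]
  calc (x / 2) ^ ρ * ((x / 2) ^ 2) ^ m * Gamma (ρ + 1)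
      = (x / 2) ^ ρ * (((x / 2) ^ 2) ^ m * Gamma (ρ + 1)) := by ring
    _ ≤ (x / 2) ^ ρ * ((1 / 2) ^ m * Gamma (m + ρ + 1)) := by gcongr
    _ ≤ (x / 2) ^ ρ * (1 / 2) ^ m * (m.factorial * Gamma (m + ρ + 1)) := by
        rw [← mul_assoc]
        gcongr
        exact le_mul_of_one_le_left hGm.le hfac

/-- Comparison of `(a / (c + 1)) ^ ρ` with a telescoping difference. -/
lemma div_rpow_le_telescope {a ρ c : ℝ} (ha : 0 < a) (hρ : 2 ≤ ρ) (hc : 0 < c) :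
    (a / (c + 1)) ^ ρ ≤
      a / (ρ - 1) * (a / c) ^ (ρ - 1) - a / (ρ - 1) * (a / (c + 1)) ^ (ρ - 1) := by
  have hρ1 : 0 < ρ - 1 := by linarith
  have hbern : 1 + (ρ - 1) * (1 / c) ≤ (1 + 1 / c) ^ (ρ - 1) :=
    one_add_mul_self_le_rpow_one_add (by linarith [one_div_pos.2 hc]) (by linarith)
  set y := (a / (c + 1)) ^ (ρ - 1) with hy
  have hypos : 0 < y := by positivity
  have h1 : (a / (c + 1)) ^ ρ = y * (a / (c + 1)) := by
    rw [hy, ← rpow_add_one (by positivity), sub_add_cancel]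
  have h2 : (a / c) ^ (ρ - 1) = y * (1 + 1 / c) ^ (ρ - 1) := by
    rw [hy, ← mul_rpow (by positivity) (by positivity)]
    congr 1
    field_simp
  rw [h1, h2]
  calc y * (a / (c + 1)) ≤ y * (a / c) := by gcongr; linarith
    _ = a / (ρ - 1) * (y * (1 + (ρ - 1) * (1 / c))) - a / (ρ - 1) * y := by
        field_simp
        ring
    _ ≤ _ := by gcongr

lemma sum_range_div_rpow_le {a ρ : ℝ} (ha : 0 < a) (hρ : 2 ≤ ρ) {N : ℕ} (hN : 0 < N)
    (haN : a ≤ N) (n : ℕ) :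
    ∑ i ∈ Finset.range n, (a / ((N + i : ℕ) : ℝ)) ^ ρ ≤ 1 + a / (ρ - 1) := by
  have hρ1 : 0 < ρ - 1 := by linarith
  have hN' : (0 : ℝ) < N := by exact_mod_cast hN
  have hle : a / (N : ℝ) ≤ 1 := (div_le_one hN').2 haN
  have htel : ∀ n : ℕ, ∑ i ∈ Finset.range (n + 1), (a / ((N + i : ℕ) : ℝ)) ^ ρ ≤
      1 + a / (ρ - 1) - a / (ρ - 1) * (a / ((N + n : ℕ) : ℝ)) ^ (ρ - 1) := by
    intro n
    induction n with
    | zero =>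
      have h1 : (a / (N : ℝ)) ^ ρ ≤ (a / (N : ℝ)) ^ (ρ - 1) * (a / (N : ℝ)) := by
        rw [← rpow_add_one (by positivity), sub_add_cancel]
      have h2 : (a / (N : ℝ)) ^ (ρ - 1) ≤ 1 := rpow_le_one (by positivity) hle hρ1.le
      have h3 : (a / (N : ℝ)) ^ ρ ≤ 1 := rpow_le_one (by positivity) hle (by linarith)
      have h4 : a / (ρ - 1) * (a / (N : ℝ)) ^ (ρ - 1) ≤ a / (ρ - 1) :=
        mul_le_of_le_one_right (by positivity) h2
      simp only [zero_add, Finset.sum_range_one, add_zero]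
      linarith
    | succ n ih =>
      rw [Finset.sum_range_succ]
      have := div_rpow_le_telescope (c := ((N + n : ℕ) : ℝ)) ha hρ (by positivity)
      rw [← add_assoc N n 1]
      push_cast at *
      linarith
  calc ∑ i ∈ Finset.range n, (a / ((N + i : ℕ) : ℝ)) ^ ρ
      ≤ ∑ i ∈ Finset.range (n + 1), (a / ((N + i : ℕ) : ℝ)) ^ ρ :=
        Finset.sum_le_sum_of_subset_of_nonneg (Finset.range_mono n.le_succ)
          fun _ _ _ => by positivity
    _ ≤ _ := (htel n).trans (sub_le_self _ (by positivity))

/-- Every finite partial sum of `(a / c) ^ ρ` over integers `c ≥ max(1, a)` is at most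
`1 + a / (ρ - 1)`. -/
lemma sum_subtype_div_rpow_le {a ρ : ℝ} (ha : 0 < a) (hρ : 2 ≤ ρ)
    (s : Finset {c : ℕ // 0 < c ∧ a ≤ (c : ℝ)}) :
    ∑ c ∈ s, (a / ((c : ℕ) : ℝ)) ^ ρ ≤ 1 + a / (ρ - 1) := by
  set N := ⌈a⌉₊ with hN
  have hmem : ∀ c ∈ s, N ≤ (c : ℕ) := fun c _ => Nat.ceil_le.2 c.2.2
  refine le_trans ?_ (sum_range_div_rpow_le ha hρ (Nat.ceil_pos.2 ha) (Nat.le_ceil a)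
    ((s.image fun c => c.1 - N).sup id + 1))
  have hinj : Set.InjOn (fun c : {c : ℕ // 0 < c ∧ a ≤ (c : ℝ)} => (c : ℕ) - N) s := by
    intro c hc d hd h
    have := hmem c hc
    have := hmem d hd
    apply Subtype.ext
    dsimp only at h
    omega
  calc ∑ c ∈ s, (a / ((c : ℕ) : ℝ)) ^ ρ
      = ∑ i ∈ s.image fun c => c.1 - N, (a / ((N + i : ℕ) : ℝ)) ^ ρ := by
        rw [Finset.sum_image hinj]
        refine Finset.sum_congr rfl fun c hc => ?_
        rw [Nat.add_sub_cancel' (hmem c hc)]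
    _ ≤ _ := by
        refine Finset.sum_le_sum_of_subset_of_nonneg (fun i hi => ?_) fun _ _ _ => by positivity
        exact Finset.mem_range.2 (Nat.lt_succ_of_le (Finset.le_sup (f := id) hi))

lemma sqrt_rpow_div_Gamma_le {ρ : ℝ} (hρ : 2 ≤ ρ) :
    √(ρ / 8) ^ ρ / Gamma (ρ + 1) ≤ exp 20 * (ρ + 1) ^ (-(ρ + 1) / 2) := by
  have h0 : 0 < ρ := by linarith
  have hlog8 : log 8 = 3 * log 2 := by
    rw [show (8 : ℝ) = 2 ^ 3 by norm_num, log_pow]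
    norm_num
  have hnum : √(ρ / 8) ^ ρ = exp ((log ρ - 3 * log 2) / 2 * ρ) := by
    rw [rpow_def_of_pos (by positivity), log_sqrt (by positivity),
      log_div h0.ne' (by norm_num), hlog8]
  have hden : exp (log ρ * ρ - ρ) ≤ Gamma (ρ + 1) := by
    have := rpow_mul_exp_neg_le_Gamma_add_one h0
    rwa [rpow_def_of_pos h0, ← exp_add, ← sub_eq_add_neg] at this
  have hdiff : ρ * (log (ρ + 1) - log ρ) ≤ 1 := by
    rw [← log_div (by positivity) h0.ne']
    have h := log_le_sub_one_of_pos (show 0 < (ρ + 1) / ρ by positivity)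
    calc ρ * log ((ρ + 1) / ρ) ≤ ρ * ((ρ + 1) / ρ - 1) := by gcongr
      _ = 1 := by field_simp; ring
  have hgrow : log (ρ + 1) ≤ (ρ + 1) / 20 + 19 := by
    have h := log_le_sub_one_of_pos (show 0 < (ρ + 1) / 20 by positivity)
    rw [log_div (by positivity) (by norm_num)] at h
    have h' := log_le_sub_one_of_pos (show (0 : ℝ) < 20 by norm_num)
    linarith
  have hlog2 := log_two_gt_d9
  calc √(ρ / 8) ^ ρ / Gamma (ρ + 1)
      ≤ exp ((log ρ - 3 * log 2) / 2 * ρ) / exp (log ρ * ρ - ρ) := by rw [hnum]; gcongr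
    _ = exp ((log ρ - 3 * log 2) / 2 * ρ - (log ρ * ρ - ρ)) := (exp_sub _ _).symm
    _ ≤ exp (20 + log (ρ + 1) * (-(ρ + 1) / 2)) := by
        apply exp_le_exp.2
        nlinarith
    _ = _ := by rw [exp_add, rpow_def_of_pos (by positivity)]

lemma tail_start_div_le {k M : ℝ} (hk : 3 ≤ k) (hM : 0 < M) :
    4 * π * √(2 / (k - 1)) * M / (k - 1 - 1) ≤ 24 * π * (M * k ^ (-(3 : ℝ) / 2)) := by
  have hk0 : 0 < k := by linarith
  have hsqrt : √(2 / (k - 1)) ≤ 2 * k ^ (-(1 : ℝ) / 2) := by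
    have h : (2 * k ^ (-(1 : ℝ) / 2)) ^ 2 = 4 / k := by
      rw [mul_pow, ← rpow_natCast (k ^ _), ← rpow_mul hk0.le]
      norm_num [rpow_neg_one]
      rfl
    apply sqrt_le_iff.2 ⟨by positivity, ?_⟩
    rw [h, div_le_div_iff₀ (by linarith) hk0]
    linarith
  have hinv : (k - 1 - 1)⁻¹ ≤ 3 * k⁻¹ := by
    rw [← div_eq_mul_inv, inv_eq_one_div, div_le_div_iff₀ (by linarith) hk0]
    linarith
  have hpow : k ^ (-(3 : ℝ) / 2) = k ^ (-(1 : ℝ) / 2) * k⁻¹ := by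
    rw [← rpow_neg_one k, ← rpow_add hk0]
    norm_num
  rw [div_eq_mul_inv, hpow]
  have : 0 ≤ (k - 1 - 1)⁻¹ := inv_nonneg.2 (by linarith)
  calc 4 * π * √(2 / (k - 1)) * M * (k - 1 - 1)⁻¹
      ≤ 4 * π * (2 * k ^ (-(1 : ℝ) / 2)) * M * (3 * k⁻¹) := by gcongr
    _ = _ := by ring

lemma abs_besselJ_div_le {ρ M c : ℝ} (hρ : 2 ≤ ρ) (hM : 0 < M) (hc : 0 < c)
    (hMc : 4 * π * √(2 / ρ) * M ≤ c) :
    |besselJ ρ (4 * π * M / c)| ≤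
      2 * exp 20 * (ρ + 1) ^ (-(ρ + 1) / 2) * (4 * π * √(2 / ρ) * M / c) ^ ρ := by
  have h0 : 0 < ρ := by linarith
  set b := 4 * π * √(2 / ρ) * M / c with hb
  have hbpos : 0 < b := by positivity
  have hb1 : b ≤ 1 := (div_le_one hc).2 hMc
  have hprod : √(2 / ρ) * √(ρ / 8) = 1 / 2 := by
    rw [← sqrt_mul (by positivity), show 2 / ρ * (ρ / 8) = (1 / 2) ^ 2 by field_simp; norm_num]
    exact sqrt_sq (by norm_num)
  have hx : 4 * π * M / c / 2 = b * √(ρ / 8) := by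
    rw [show b * √(ρ / 8) = 4 * π * M / c * (√(2 / ρ) * √(ρ / 8)) by rw [hb]; ring, hprod]
    ring
  have hxsq : (4 * π * M / c) ^ 2 ≤ ρ / 2 := by
    rw [show (4 * π * M / c) ^ 2 = 4 * (4 * π * M / c / 2) ^ 2 by ring, hx, mul_pow,
      sq_sqrt (by positivity)]
    nlinarith [pow_le_one₀ hbpos.le hb1 (n := 2)]
  calc |besselJ ρ (4 * π * M / c)|
      ≤ (4 * π * M / c / 2) ^ ρ / Gamma (ρ + 1) * 2 := abs_besselJ_le_s18 h0 (by positivity) hxsq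
    _ = 2 * (√(ρ / 8) ^ ρ / Gamma (ρ + 1)) * b ^ ρ := by
        rw [hx, mul_rpow hbpos.le (sqrt_nonneg _)]
        ring
    _ ≤ 2 * (exp 20 * (ρ + 1) ^ (-(ρ + 1) / 2)) * b ^ ρ := by
        gcongr
        exact sqrt_rpow_div_Gamma_le hρ
    _ = _ := by ring

/-- There exist `K > 0` and `k₀ > 0` such that for all real `k ≥ k₀`
and `M > 0`, summing over positive integers `c` with `c ≥ 4π √(2/(k-1)) M`:
`∑_c |J_{k-1}(4πM/c)| ≤ K k^{-k/2} (1 + M k^{-3/2})`. -/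
theorem besselJ_tail_sum_region_one :
    ∃ K k₀ : ℝ, 0 < K ∧ 0 < k₀ ∧
      ∀ k M : ℝ, k₀ ≤ k → 0 < M →
        (∑' c : {c : ℕ // 0 < c ∧ 4 * π * Real.sqrt (2 / (k - 1)) * M ≤ (c : ℝ)},
            |besselJ (k - 1) (4 * π * M / ((c : ℕ) : ℝ))|)
          ≤ K * k ^ (-k / 2) * (1 + M * k ^ (-(3 : ℝ) / 2)) := by
  refine ⟨2 * exp 20 * (24 * π), 3, by positivity, by norm_num, fun k M hk hM => ?_⟩
  have hk0 : 0 < k := by linarith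
  have hρ : 2 ≤ k - 1 := by linarith
  have ha : 0 < 4 * π * √(2 / (k - 1)) * M := by
    have : 0 < k - 1 := by linarith
    positivity
  refine tsum_le_of_sum_le' (by positivity) fun s => ?_
  calc ∑ c ∈ s, |besselJ (k - 1) (4 * π * M / ((c : ℕ) : ℝ))|
      ≤ ∑ c ∈ s, 2 * exp 20 * k ^ (-k / 2) *
          (4 * π * √(2 / (k - 1)) * M / ((c : ℕ) : ℝ)) ^ (k - 1) := by
        refine Finset.sum_le_sum fun c _ => ?_
        simpa only [sub_add_cancel] using
          abs_besselJ_div_le hρ hM (Nat.cast_pos.2 c.2.1) c.2.2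
    _ ≤ 2 * exp 20 * k ^ (-k / 2) * (1 + 4 * π * √(2 / (k - 1)) * M / (k - 1 - 1)) := by
        rw [← Finset.mul_sum]
        gcongr
        exact sum_subtype_div_rpow_le ha hρ s
    _ ≤ 2 * exp 20 * k ^ (-k / 2) * (24 * π * (1 + M * k ^ (-(3 : ℝ) / 2))) := by
        gcongr
        linarith [tail_start_div_le hk hM, pi_gt_three]
    _ = _ := by ring
end
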